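/- arXiv:1912.11790 — 2 statements merged into one kernel-verified Lean document; each statement's English description precedes it below -/
import Mathlib

section
/- For every integer n ≥ 1, every real v > 0 and every real x with 0 ≤ x < n, one has H_n(x, v) ≤ e^x · (v²/(x+v²))^{x+v²}. -/
open Real

/-- The Hoeffding-type bounding function `H_n(x, v)`:
`H_n(x,v) = [(v²/(x+v²))^(x+v²) · (n/(n−x))^(n−x)]^(n/(n+v²))` for `0 ≤ x < n`,
with `H_n(n,v) = 1` and `H_n(x,v) = 0` for `x > n`. -/
noncomputable def H (n : ℕ) (x v : ℝ) : ℝ :=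
  if x < (n : ℝ) then
    ((v ^ 2 / (x + v ^ 2)) ^ (x + v ^ 2) *
      ((n : ℝ) / ((n : ℝ) - x)) ^ ((n : ℝ) - x)) ^ ((n : ℝ) / ((n : ℝ) + v ^ 2))
  else if x = (n : ℝ) then 1 else 0

theorem log_le_half_sub_inv {y : ℝ} (hy : 1 ≤ y) : Real.log y ≤ (y - y⁻¹) / 2 := by
  rw [← Real.sinh_log (by linarith)]
  exact Real.self_le_sinh_iff.mpr (Real.log_nonneg hy)

theorem mul_log_div_le {a b : ℝ} (hb : 0 < b) (hab : b ≤ a) :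
    a * b * Real.log (a / b) ≤ (a ^ 2 - b ^ 2) / 2 := by
  have ha : 0 < a := hb.trans_le hab
  calc a * b * Real.log (a / b) ≤ a * b * ((a / b - (a / b)⁻¹) / 2) :=
        mul_le_mul_of_nonneg_left (log_le_half_sub_inv ((one_le_div hb).mpr hab)) (by positivity)
    _ = (a ^ 2 - b ^ 2) / 2 := by field_simp

/-- `H_n(x, v) ≤ e^x · (v²/(x+v²))^(x+v²)` for `0 ≤ x < n` and `v > 0`. -/
theorem H_le_exp_mul (n : ℕ) (hn : 1 ≤ n) (v : ℝ) (hv : 0 < v)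
    (x : ℝ) (hx0 : 0 ≤ x) (hxn : x < (n : ℝ)) :
    H n x v ≤ Real.exp x * (v ^ 2 / (x + v ^ 2)) ^ (x + v ^ 2) := by
  have hw : 0 < v ^ 2 := by positivity
  rw [H, if_pos hxn]
  generalize v ^ 2 = w at hw ⊢
  have hn0 : (0 : ℝ) < n := hx0.trans_lt hxn
  have hnx : 0 < (n : ℝ) - x := sub_pos.mpr hxn
  have hxw : 0 < x + w := by positivity
  have h₁ := mul_log_div_le hnx (sub_le_self (n : ℝ) hx0)
  have h₂ := mul_log_div_le hw (le_add_of_nonneg_left hx0 : w ≤ x + w)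
  rw [← inv_div w (x + w), Real.log_inv] at h₂
  rw [← Real.log_le_log_iff (by positivity) (by positivity), Real.log_rpow (by positivity),
    Real.log_mul (by positivity) (by positivity), Real.log_mul (by positivity) (by positivity),
    Real.log_rpow (by positivity), Real.log_rpow (by positivity), Real.log_exp, div_mul_eq_mul_div,
    div_le_iff₀ (by positivity)]
  linarith
end

section
/- For every integer n ≥ 1 and every real v > 0, one has H_n(0, v) = 1, and consequently H_n(x, v) ≤ 1 for every real x ≥ 0. -/
open Real

theorem div_rpow_le_exp_sub {a b : ℝ} (ha : 0 < a) (hb : 0 < b) :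
    (a / b) ^ b ≤ exp (a - b) := by
  rw [rpow_def_of_pos (div_pos ha hb), exp_le_exp]
  calc log (a / b) * b ≤ (a / b - 1) * b := by
        gcongr
        exact log_le_sub_one_of_pos (div_pos ha hb)
    _ = a - b := by field_simp

/-- `H_n(0, v) = 1`, and consequently `H_n(x, v) ≤ 1` for every `x ≥ 0`. -/
theorem H_zero_eq_one_and_le_one (n : ℕ) (hn : 1 ≤ n) (v : ℝ) (hv : 0 < v) :
    H n 0 v = 1 ∧ ∀ x : ℝ, 0 ≤ x → H n x v ≤ 1 := by
  have hn0 : (0 : ℝ) < n := by exact_mod_cast hn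
  have hv2 : 0 < v ^ 2 := by positivity
  refine ⟨by simp [H, hn0, div_self hn0.ne', div_self hv2.ne'], fun x hx => ?_⟩
  unfold H
  split_ifs with hxn hxn
  · have hnx : 0 < (n : ℝ) - x := sub_pos.2 hxn
    refine rpow_le_one (by positivity) ?_ (by positivity)
    calc _ ≤ exp (v ^ 2 - (x + v ^ 2)) * exp ((n : ℝ) - (n - x)) := by
          gcongr
          · exact div_rpow_le_exp_sub hv2 (by positivity)
          · exact div_rpow_le_exp_sub hn0 hnx
      _ = 1 := by rw [← exp_add, exp_eq_one_iff]; ring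
  · exact le_rfl
  · exact zero_le_one
end
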